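/- For every real \(\beta > 0\), every real c with 0 < c < 1, every natural number x, and every real t with \(|t| < \tfrac{1-c}{c}\), the series \(\sum_{n=0}^{\infty} \frac{(\beta)_n}{n!} \big(\tfrac{c}{c-1}\big)^n M_n(x;\beta,c)\, t^n\) converges and equals \(\Big(\tfrac{1-c+t}{1-c+ct}\Big)^x \Big(\tfrac{1-c+ct}{1-c}\Big)^{-\beta}\). -/

import Mathlib

open Nat

/-- The Pochhammer symbol `(a)_k = a (a+1) ⋯ (a+k-1)`. -/
noncomputable def poch (a : ℝ) (k : ℕ) : ℝ :=
  ∏ j ∈ Finset.range k, (a + (j : ℝ))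

/-- The Meixner polynomials
`M_n(x;β,c) = ∑_{k=0}^n (-n)_k (-x)_k / ((β)_k k!) · (1 - 1/c)^k`. -/
noncomputable def meixner (n : ℕ) (x : ℕ) (β c : ℝ) : ℝ :=
  ∑ k ∈ Finset.range (n + 1),
    poch (-(n : ℝ)) k * poch (-(x : ℝ)) k / (poch β k * (k ! : ℝ)) * (1 - 1 / c) ^ k

theorem poch_eq_eval_ascPochhammer (a : ℝ) (k : ℕ) : poch a k = (ascPochhammer ℝ k).eval a := by
  induction k with
  | zero => simp [poch]
  | succ k ih => rw [poch, Finset.prod_range_succ, ← poch, ih, ascPochhammer_succ_eval]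

theorem poch_pos {a : ℝ} (ha : 0 < a) (k : ℕ) : 0 < poch a k :=
  Finset.prod_pos fun _ _ => by positivity

theorem poch_add (a : ℝ) (k m : ℕ) : poch a (k + m) = poch a k * poch (a + k) m := by
  simp [poch, Finset.prod_range_add, add_assoc]

theorem poch_neg_natCast (n k : ℕ) :
    poch (-(n : ℝ)) k = (-1) ^ k * ((k ! : ℝ) * (n.choose k : ℝ)) := by
  rw [poch_eq_eval_ascPochhammer, ascPochhammer_eval_neg_eq_descPochhammer,
    descPochhammer_eval_eq_descFactorial, Nat.descFactorial_eq_factorial_mul_choose]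
  push_cast
  rfl

theorem meixner_eq_sum_choose (n x : ℕ) (β c : ℝ) :
    meixner n x β c = ∑ k ∈ Finset.range (x + 1),
      (n.choose k : ℝ) * x.choose k * (k ! : ℝ) / poch β k * (1 - 1 / c) ^ k := by
  have key : meixner n x β c = ∑ k ∈ Finset.range (n + 1),
      (n.choose k : ℝ) * x.choose k * (k ! : ℝ) / poch β k * (1 - 1 / c) ^ k := by
    refine Finset.sum_congr rfl fun k _ => ?_
    have hk : (k ! : ℝ) ≠ 0 := by positivity
    have h1 : ((-1 : ℝ) ^ k) * (-1) ^ k = 1 := by rw [← mul_pow]; simp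
    rw [poch_neg_natCast, poch_neg_natCast, ← mul_div_mul_right _ (poch β k) hk]
    congr 2
    linear_combination ((k ! : ℝ) * n.choose k * (k ! * x.choose k)) * h1
  rw [key]
  rcases le_total n x with h | h
  · refine Finset.sum_subset (Finset.range_mono (by lia)) fun k _ hk => ?_
    simp [Nat.choose_eq_zero_of_lt (show n < k by simpa using hk)]
  · refine (Finset.sum_subset (Finset.range_mono (by lia)) fun k _ hk => ?_).symm
    simp [Nat.choose_eq_zero_of_lt (show x < k by simpa using hk)]

/-- The binomial series for `(1 - s) ^ (-a)`. -/
theorem hasSum_poch_div_factorial_mul_pow (a : ℝ) {s : ℝ} (hs : |s| < 1) :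
    HasSum (fun m : ℕ => poch a m / (m ! : ℝ) * s ^ m) ((1 - s) ^ (-a)) := by
  have h := (Real.one_div_one_sub_rpow_hasFPowerSeriesOnBall_zero a).hasSum (y := s)
    (by simpa [enorm_eq_nnnorm] using! hs)
  rw [zero_add, one_div, ← Real.rpow_neg (by linarith [(abs_lt.mp hs).2])] at h
  convert! h using 2 with m
  have hm := Ring.factorial_nsmul_multichoose_eq_ascPochhammer a m
  rw [Polynomial.ascPochhammer_smeval_eq_eval, ← poch_eq_eval_ascPochhammer, nsmul_eq_mul] at hm
  have hm' : (m ! : ℝ) ≠ 0 := by positivity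
  have ha : a + m - 1 - m + 1 = a := by ring
  simp [Ring.choose, ha, ← hm]
  field_simp

theorem hasSum_poch_div_factorial_mul_choose (β : ℝ) (k : ℕ) {s : ℝ} (hs : |s| < 1) :
    HasSum (fun n : ℕ => poch β n / (n ! : ℝ) * n.choose k * s ^ n)
      (poch β k / (k ! : ℝ) * s ^ k * (1 - s) ^ (-(β + k))) := by
  have hinj : Function.Injective (fun m : ℕ => k + m) := add_right_injective k
  refine (hinj.hasSum_iff fun n hn => ?_).mp ?_
  · have : n < k := by
      by_contra! h
      exact hn ⟨n - k, by simp; lia⟩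
    simp [Nat.choose_eq_zero_of_lt this]
  · convert! (hasSum_poch_div_factorial_mul_pow (β + k) hs).mul_left
      (poch β k / (k ! : ℝ) * s ^ k) using 2 with m
    have hkm : ((k + m).choose k : ℝ) * k ! * m ! = (k + m)! := by
      rw [Nat.choose_symm_add]
      exact_mod_cast Nat.add_choose_mul_factorial_mul_factorial k m
    simp only [Function.comp_apply]
    rw [← hkm, poch_add, pow_add]
    have : ((k + m).choose k : ℝ) ≠ 0 := by
      exact_mod_cast (Nat.choose_pos (Nat.le_add_right k m)).ne'
    field_simp

/-- Generating function of the Meixner polynomials: for `|t| < (1-c)/c`,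
`∑_{n=0}^∞ (β)_n/n! (c/(c-1))^n M_n(x;β,c) t^n
  = ((1-c+t)/(1-c+ct))^x ((1-c+ct)/(1-c))^(-β)`. -/
theorem meixner_generating_function (β : ℝ) (hβ : 0 < β) (c : ℝ) (hc0 : 0 < c) (hc1 : c < 1)
    (x : ℕ) (t : ℝ) (ht : |t| < (1 - c) / c) :
    HasSum (fun n : ℕ => poch β n / (n ! : ℝ) * (c / (c - 1)) ^ n * meixner n x β c * t ^ n)
      (((1 - c + t) / (1 - c + c * t)) ^ x * ((1 - c + c * t) / (1 - c)) ^ (-β)) := by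
  have hc : 0 < 1 - c := by linarith
  have hc' : c - 1 ≠ 0 := by linarith
  set s : ℝ := c / (c - 1) * t with hs_def
  have hs : |s| < 1 := by
    rw [hs_def, abs_mul, abs_div, abs_of_pos hc0, abs_of_neg (by linarith : c - 1 < 0)]
    calc c / -(c - 1) * |t| < c / -(c - 1) * ((1 - c) / c) := by
          have : 0 < -(c - 1) := by linarith
          gcongr
      _ = 1 := by rw [neg_sub]; field_simp
  have hs1 : 0 < 1 - s := by linarith [(abs_lt.mp hs).2]
  have h1s : (1 - c + c * t) / (1 - c) = 1 - s := by
    rw [hs_def]; field_simp; ring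
  have hd : 1 - c + c * t = (1 - s) * (1 - c) := by rw [← h1s]; field_simp
  have hst : (1 - 1 / c) * s = t := by
    rw [hs_def]; field_simp
  have hbase : (1 - c + t) / (1 - c + c * t) = t / (1 - s) + 1 := by
    rw [hd]; field_simp; linear_combination hd
  have h := hasSum_sum (s := Finset.range (x + 1)) fun k _ =>
    (hasSum_poch_div_factorial_mul_choose β k hs).mul_left
      ((x.choose k : ℝ) * (k ! : ℝ) / poch β k * (1 - 1 / c) ^ k)
  convert! h using 1
  · funext n
    rw [meixner_eq_sum_choose, Finset.mul_sum, Finset.sum_mul]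
    refine Finset.sum_congr rfl fun k _ => ?_
    rw [hs_def, mul_pow]
    ring
  · rw [hbase, h1s, add_pow, Finset.sum_mul]
    refine Finset.sum_congr rfl fun k _ => ?_
    have hk : poch β k ≠ 0 := (poch_pos hβ k).ne'
    have hk' : (k ! : ℝ) ≠ 0 := by positivity
    rw [neg_add, Real.rpow_add hs1, Real.rpow_neg hs1.le (k : ℝ), Real.rpow_natCast, div_pow]
    nth_rewrite 1 [← hst]
    rw [mul_pow]
    field_simp
    simp
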